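/- Let a < b be reals and let p₁, p₂ : [a,b] → [1,∞) be Lebesgue integrable with p₁(x) ≤ p₂(x) for almost every x ∈ [a,b]. Then WBV_{p₁(·)}[a,b] ⊆ WBV_{p₂(·)}[a,b], and for every f ∈ WBV_{p₁(·)}[a,b] one has ‖f‖_{WBV_{p₂(·)}} ≤ ‖f‖_{WBV_{p₁(·)}}. -/

import Mathlib

open MeasureTheory Set Filter
open scoped ENNReal

/-- The harmonic mean exponent `p̄([u,v]) = ((v-u)⁻¹ ∫_u^v 1/p)⁻¹`. -/
noncomputable def pbar (p : ℝ → ℝ) (u v : ℝ) : ℝ :=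
  ((v - u)⁻¹ * ∫ t in u..v, (p t)⁻¹)⁻¹

/-- `t 0 = c < t 1 < ⋯ < t n = d` is a partition of `[c,d]`. -/
def IsPartition (c d : ℝ) (n : ℕ) (t : ℕ → ℝ) : Prop :=
  0 < n ∧ t 0 = c ∧ t n = d ∧ ∀ k < n, t k < t (k + 1)

/-- The Wiener variable-exponent variation `V_c^d(p, f)`, valued in `[0,∞]`. -/
noncomputable def wienerVar (p f : ℝ → ℝ) (c d : ℝ) : ℝ≥0∞ :=
  ⨆ (n : ℕ) (t : ℕ → ℝ) (_ : IsPartition c d n t),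
    ENNReal.ofReal (∑ k ∈ Finset.range n,
      |f (t (k + 1)) - f (t k)| ^ pbar p (t k) (t (k + 1)))

/-- The Luxemburg norm `inf {λ > 0 : V_a^b(p, f/λ) ≤ 1}`, valued in `[0,∞]`. -/
noncomputable def luxNorm (p f : ℝ → ℝ) (a b : ℝ) : ℝ≥0∞ :=
  ⨅ (l : ℝ) (_ : 0 < l) (_ : wienerVar p (fun x => f x / l) a b ≤ 1),
    ENNReal.ofReal l

/-- Membership in the space `WBV_{p(·)}[a,b]`. -/
def MemWBV (p f : ℝ → ℝ) (a b : ℝ) : Prop :=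
  f a = 0 ∧ luxNorm p f a b < ⊤


lemma IsPartition.mem_Icc {c d : ℝ} {n : ℕ} {t : ℕ → ℝ} (h : IsPartition c d n t)
    {k : ℕ} (hk : k ≤ n) : t k ∈ Icc c d := by
  obtain ⟨-, h0, hn, hlt⟩ := h
  constructor
  · induction k with
    | zero => exact h0.ge
    | succ k ih => exact (ih (by omega)).trans (hlt k (by omega)).le
  · induction hk using Nat.decreasingInduction with
    | self => exact hn.le
    | of_succ k hk ih => exact (hlt k hk).le.trans ih

lemma intervalIntegrable_inv_of_one_le {p : ℝ → ℝ} {u v : ℝ} (huv : u ≤ v)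
    (h1 : ∀ x ∈ Icc u v, 1 ≤ p x) (hp : IntegrableOn p (Icc u v)) :
    IntervalIntegrable (fun t => (p t)⁻¹) volume u v := by
  rw [intervalIntegrable_iff_integrableOn_Icc_of_le huv]
  have hm : AEStronglyMeasurable (fun t => (p t)⁻¹) (volume.restrict (Icc u v)) :=
    hp.aestronglyMeasurable.aemeasurable.inv.aestronglyMeasurable
  refine Integrable.of_bound hm 1 ?_
  filter_upwards [ae_restrict_mem measurableSet_Icc] with x hx
  have := h1 x hx
  rw [Real.norm_of_nonneg (by positivity)]
  exact inv_le_one_of_one_le₀ this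

lemma integral_inv_pos_of_one_le {p : ℝ → ℝ} {u v : ℝ} (huv : u < v)
    (h1 : ∀ x ∈ Icc u v, 1 ≤ p x) (hp : IntegrableOn p (Icc u v)) :
    0 < ∫ t in u..v, (p t)⁻¹ :=
  intervalIntegral.intervalIntegral_pos_of_pos_on
    (intervalIntegrable_inv_of_one_le huv.le h1 hp)
    (fun x hx => inv_pos.2 (zero_lt_one.trans_le (h1 x (Ioo_subset_Icc_self hx)))) huv

lemma pbar_pos {p : ℝ → ℝ} {u v : ℝ} (huv : u < v)
    (h1 : ∀ x ∈ Icc u v, 1 ≤ p x) (hp : IntegrableOn p (Icc u v)) : 0 < pbar p u v :=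
  inv_pos.2 (mul_pos (inv_pos.2 (sub_pos.2 huv)) (integral_inv_pos_of_one_le huv h1 hp))

lemma pbar_mono {p₁ p₂ : ℝ → ℝ} {u v : ℝ} (huv : u < v)
    (h₁ : ∀ x ∈ Icc u v, 1 ≤ p₁ x) (h₂ : ∀ x ∈ Icc u v, 1 ≤ p₂ x)
    (hp₁ : IntegrableOn p₁ (Icc u v)) (hp₂ : IntegrableOn p₂ (Icc u v))
    (hle : ∀ᵐ x ∂(volume.restrict (Icc u v)), p₁ x ≤ p₂ x) :
    pbar p₁ u v ≤ pbar p₂ u v := by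
  have huv' : 0 < (v - u)⁻¹ := inv_pos.2 (sub_pos.2 huv)
  refine inv_anti₀ (mul_pos huv' (integral_inv_pos_of_one_le huv h₂ hp₂))
    (mul_le_mul_of_nonneg_left ?_ huv'.le)
  refine intervalIntegral.integral_mono_ae_restrict huv.le
    (intervalIntegrable_inv_of_one_le huv.le h₂ hp₂)
    (intervalIntegrable_inv_of_one_le huv.le h₁ hp₁) ?_
  filter_upwards [hle, ae_restrict_mem measurableSet_Icc] with x hx hmem
  exact inv_anti₀ (zero_lt_one.trans_le (h₁ x hmem)) hx

lemma wienerVar_le_of_le_one {a b : ℝ} {p₁ p₂ : ℝ → ℝ}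
    (h₁ : ∀ x ∈ Icc a b, 1 ≤ p₁ x) (h₂ : ∀ x ∈ Icc a b, 1 ≤ p₂ x)
    (hp₁ : IntegrableOn p₁ (Icc a b)) (hp₂ : IntegrableOn p₂ (Icc a b))
    (hle : ∀ᵐ x ∂(volume.restrict (Icc a b)), p₁ x ≤ p₂ x)
    {g : ℝ → ℝ} (hg : wienerVar p₁ g a b ≤ 1) :
    wienerVar p₂ g a b ≤ wienerVar p₁ g a b := by
  refine iSup_mono fun n => iSup_mono fun t => iSup_mono fun ht => ENNReal.ofReal_le_ofReal ?_
  have hsum : ∑ k ∈ Finset.range n,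
      |g (t (k + 1)) - g (t k)| ^ pbar p₁ (t k) (t (k + 1)) ≤ 1 := by
    rw [← ENNReal.ofReal_le_one]
    refine le_trans ?_ hg
    exact le_iSup_of_le n (le_iSup_of_le t (le_iSup_of_le ht le_rfl))
  refine Finset.sum_le_sum fun k hk => ?_
  have hterm := (Finset.single_le_sum
    (f := fun k => |g (t (k + 1)) - g (t k)| ^ pbar p₁ (t k) (t (k + 1)))
    (fun _ _ => by positivity) hk).trans hsum
  have hkn := Finset.mem_range.1 hk
  have hlt := ht.2.2.2 k hkn
  have hsub : Icc (t k) (t (k + 1)) ⊆ Icc a b :=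
    Icc_subset_Icc (ht.mem_Icc hkn.le).1 (ht.mem_Icc hkn).2
  have hpos := pbar_pos hlt (fun x hx => h₁ x (hsub hx)) (hp₁.mono_set hsub)
  refine Real.rpow_le_rpow_of_exponent_ge' (abs_nonneg _) ?_ hpos.le
    (pbar_mono hlt (fun x hx => h₁ x (hsub hx)) (fun x hx => h₂ x (hsub hx))
      (hp₁.mono_set hsub) (hp₂.mono_set hsub) (ae_restrict_of_ae_restrict_of_subset hsub hle))
  by_contra! hgt
  exact (Real.one_lt_rpow hgt hpos).not_ge hterm

/-- if `p₁ ≤ p₂` a.e. on `[a,b]` then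
`WBV_{p₁(·)}[a,b] ⊆ WBV_{p₂(·)}[a,b]` with `‖f‖_{p₂} ≤ ‖f‖_{p₁}`. -/
theorem wbv_mono_exponent (a b : ℝ) (hab : a < b) (p₁ p₂ : ℝ → ℝ)
    (hp₁1 : ∀ x ∈ Set.Icc a b, 1 ≤ p₁ x) (hp₂1 : ∀ x ∈ Set.Icc a b, 1 ≤ p₂ x)
    (hp₁int : MeasureTheory.IntegrableOn p₁ (Set.Icc a b))
    (hp₂int : MeasureTheory.IntegrableOn p₂ (Set.Icc a b))
    (hle : ∀ᵐ x ∂(volume.restrict (Set.Icc a b)), p₁ x ≤ p₂ x)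
    (f : ℝ → ℝ) (hf : MemWBV p₁ f a b) :
    MemWBV p₂ f a b ∧ luxNorm p₂ f a b ≤ luxNorm p₁ f a b := by
  have hnorm : luxNorm p₂ f a b ≤ luxNorm p₁ f a b :=
    iInf_mono fun l => iInf_mono fun _ => iInf_mono' fun hl =>
      ⟨(wienerVar_le_of_le_one hp₁1 hp₂1 hp₁int hp₂int hle hl).trans hl, le_rfl⟩
  exact ⟨⟨hf.1, hnorm.trans_lt hf.2⟩, hnorm⟩
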